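/- Let P = (P_j) be a sequence of finite nonempty subsets of ℤ. Let T be an invertible measure-preserving transformation of a standard probability space (X,μ) with completely positive P-entropy, i.e., h_P(T, ℱ) > 0 for every nontrivial T-invariant sub-σ-algebra ℱ. Let S be an invertible measure-preserving transformation of a standard probability space (Y,ν) with h_P(S) = 0. Then T and S are disjoint: every T×S-invariant probability measure on X×Y whose marginals are μ and ν equals the product measure μ⊗ν. -/

import Mathlib

open MeasureTheory
open scoped symmDiff ENNReal

noncomputable section

/-- The Shannon entropy `H(ξ) = -∑ᵢ μ(Cᵢ) log μ(Cᵢ)` of the finite measurable partition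
`ξ` of `X` whose cells are the fibers `Cᵢ = f⁻¹{i}` of `f : X → I`. -/
def partitionEntropy {X I : Type*} [MeasurableSpace X] [Fintype I] (μ : Measure X)
    (f : X → I) : ℝ :=
  ∑ i, Real.negMulLog (μ (f ⁻¹' {i})).toReal

/-- `h_j(T, ξ) = H(⋁_{p ∈ P_j} T^{-p} ξ) / |P_j|`: the normalized entropy of the common
refinement of the partitions `T^{-p}ξ` for `p ∈ P_j`, where `ξ` is the partition of `X`
into the fibers of `f` (the cell of `x` in the refinement is determined by the tuple
`(f (T^p x))_{p ∈ P_j}`). -/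
def hPj {X I : Type*} [MeasurableSpace X] [Fintype I] (μ : Measure X) (T : X ≃ᵐ X)
    (Pj : Finset ℤ) (f : X → I) : ℝ :=
  partitionEntropy μ (fun x => fun p : Pj => f ((T.toEquiv ^ (p : ℤ)) x)) / (Pj.card : ℝ)

/-- `h_P(T, ξ) = limsup_j h_j(T, ξ)`: the `P`-entropy (Kirillov–Kushnirenko entropy) of
`T` with respect to the partition `ξ` of `X` into the fibers of `f`. -/
def hPpart {X I : Type*} [MeasurableSpace X] [Fintype I] (μ : Measure X) (T : X ≃ᵐ X)
    (P : ℕ → Finset ℤ) (f : X → I) : ℝ :=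
  Filter.atTop.limsup fun j => hPj μ T (P j) f

/-- `h_P(T, ℱ)`: the `P`-entropy of the factor of `T` on the sub-σ-algebra `m'`, i.e. the
supremum of `h_P(T, ξ)` over all finite `m'`-measurable partitions `ξ` (realized as
`m'`-measurable maps `f : X → Fin n`), computed in `ℝ≥0∞` (all the quantities
`h_P(T, ξ)` are nonnegative). -/
def hPfactor {X : Type*} (m' : MeasurableSpace X) [MeasurableSpace X] (μ : Measure X)
    (T : X ≃ᵐ X) (P : ℕ → Finset ℤ) : ℝ≥0∞ :=
  ⨆ (n : ℕ) (f : X → Fin n) (_ : Measurable[m'] f), ENNReal.ofReal (hPpart μ T P f)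

/-- `h_P(T)`: the `P`-entropy of `T`, the supremum of `h_P(T, ξ)` over all finite
measurable partitions `ξ`. -/
def hPent {X : Type*} [mX : MeasurableSpace X] (μ : Measure X) (T : X ≃ᵐ X)
    (P : ℕ → Finset ℤ) : ℝ≥0∞ :=
  hPfactor mX μ T P

/-- The sub-σ-algebra `m'` is `T`-invariant mod `μ`-null sets: `T⁻¹ m' = m'` mod null. -/
def InvariantSubAlg {X : Type*} [MeasurableSpace X] (μ : Measure X) (T : X → X)
    (m' : MeasurableSpace X) : Prop :=
  (∀ s, MeasurableSet[m'] s → ∃ t, MeasurableSet[m'] t ∧ μ ((T ⁻¹' s) ∆ t) = 0) ∧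
  (∀ t, MeasurableSet[m'] t → ∃ s, MeasurableSet[m'] s ∧ μ ((T ⁻¹' s) ∆ t) = 0)
open Function Filter Topology ProbabilityTheory

section Entropy

variable {Ω I J : Type*} [MeasurableSpace Ω]

lemma negMulLog_sum_le {ι : Type*} (s : Finset ι) (a : ι → ℝ) (ha : ∀ i ∈ s, 0 ≤ a i) :
    Real.negMulLog (∑ i ∈ s, a i) ≤ ∑ i ∈ s, Real.negMulLog (a i) := by
  rw [Real.negMulLog, neg_mul, Finset.sum_mul, ← Finset.sum_neg_distrib]
  refine Finset.sum_le_sum fun i hi => ?_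
  rcases (ha i hi).eq_or_lt with h | h
  · simp [← h]
  · rw [Real.negMulLog, neg_mul, neg_le_neg_iff]
    exact mul_le_mul_of_nonneg_left
      (Real.log_le_log h (Finset.single_le_sum ha hi)) h.le

lemma partitionEntropy_nonneg [Fintype I] (μ : Measure Ω) [IsProbabilityMeasure μ] (f : Ω → I) :
    0 ≤ partitionEntropy μ f :=
  Finset.sum_nonneg fun _ _ => Real.negMulLog_nonneg measureReal_nonneg measureReal_le_one

lemma measureReal_preimage_eq_sum [Fintype I] [MeasurableSpace I] [MeasurableSingletonClass I]
    (μ : Measure Ω) [IsFiniteMeasure μ] {f : Ω → I} (hf : Measurable f) (s : Finset I) :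
    μ.real (f ⁻¹' s) = ∑ i ∈ s, μ.real (f ⁻¹' {i}) := by
  rw [← map_measureReal_apply hf s.measurableSet, ← sum_measureReal_singleton]
  simp_rw [map_measureReal_apply hf (measurableSet_singleton _)]

lemma partitionEntropy_le_of_factorsThrough [Fintype I] [MeasurableSpace I]
    [MeasurableSingletonClass I] [Fintype J] (μ : Measure Ω) [IsProbabilityMeasure μ]
    {f : Ω → I} (hf : Measurable f) {g : Ω → J} (hgf : FactorsThrough g f) :
    partitionEntropy μ g ≤ partitionEntropy μ f := by
  classical
  have : Nonempty Ω := nonempty_of_isProbabilityMeasure μ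
  have : Nonempty J := this.map g
  obtain ⟨e, rfl⟩ := (factorsThrough_iff g).1 hgf
  unfold partitionEntropy
  rw [← Finset.sum_fiberwise (s := (Finset.univ : Finset I)) (g := e)]
  refine Finset.sum_le_sum fun j _ => ?_
  have h := measureReal_preimage_eq_sum μ hf (Finset.univ.filter fun i => e i = j)
  have h' : f ⁻¹' (Finset.univ.filter fun i => e i = j : Finset I) = e ∘ f ⁻¹' {j} := by
    ext; simp
  rw [h'] at h
  change Real.negMulLog (μ.real _) ≤ _
  rw [h]
  exact negMulLog_sum_le _ _ fun _ _ => measureReal_nonneg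

lemma partitionEntropy_prodMk_le [Fintype I] [MeasurableSpace I] [MeasurableSingletonClass I]
    [Fintype J] [MeasurableSpace J] [MeasurableSingletonClass J]
    (μ : Measure Ω) [IsProbabilityMeasure μ]
    {f : Ω → I} (hf : Measurable f) {g : Ω → J} (hg : Measurable g) :
    partitionEntropy μ (fun ω => (f ω, g ω)) ≤ partitionEntropy μ f + partitionEntropy μ g := by
  classical
  set a : I → ℝ := fun i => μ.real (f ⁻¹' {i}) with ha
  set b : J → ℝ := fun j => μ.real (g ⁻¹' {j}) with hb
  set p : I → J → ℝ := fun i j => μ.real ((fun ω => (f ω, g ω)) ⁻¹' {(i, j)}) with hp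
  have hfg : Measurable fun ω => (f ω, g ω) := hf.prodMk hg
  have pa : ∀ i, ∑ j, p i j = a i := fun i => by
    have h := measureReal_preimage_eq_sum μ hfg ({i} ×ˢ Finset.univ)
    rw [Finset.sum_product, Finset.sum_singleton] at h
    rw [hp, ← h, ha]
    congr 1
    ext; simp [eq_comm]
  have pb : ∀ j, ∑ i, p i j = b j := fun j => by
    have h := measureReal_preimage_eq_sum μ hfg (Finset.univ ×ˢ {j})
    rw [Finset.sum_product] at h
    simp only [Finset.sum_singleton] at h
    rw [hp, ← h, hb]
    congr 1
    ext; simp [eq_comm]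
  have a1 : ∑ i, a i = 1 := by
    have h := measureReal_preimage_eq_sum μ hf Finset.univ
    simpa using h.symm
  have b1 : ∑ j, b j = 1 := by
    have h := measureReal_preimage_eq_sum μ hg Finset.univ
    simpa using h.symm
  have p0 : ∀ i j, 0 ≤ p i j := fun _ _ => measureReal_nonneg
  have key : ∀ i j, Real.negMulLog (p i j) ≤
      -(p i j * Real.log (a i)) - p i j * Real.log (b j) + (a i * b j - p i j) := fun i j => by
    have hpa : p i j ≤ a i := pa i ▸ Finset.single_le_sum (fun j _ => p0 i j) (Finset.mem_univ j)
    have hpb : p i j ≤ b j :=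
      pb j ▸ Finset.single_le_sum (f := fun i => p i j) (fun i _ => p0 i j) (Finset.mem_univ i)
    rcases (p0 i j).eq_or_lt with h | h
    · rw [← h] at hpa hpb ⊢
      simpa using mul_nonneg hpa hpb
    · have h1 : 0 < a i := h.trans_le hpa
      have h2 : 0 < b j := h.trans_le hpb
      have h3 := Real.log_le_sub_one_of_pos (div_pos (mul_pos h1 h2) h)
      rw [Real.log_div (by positivity) h.ne', Real.log_mul h1.ne' h2.ne'] at h3
      have h4 := mul_le_mul_of_nonneg_left h3 h.le
      have h5 : p i j * (a i * b j / p i j - 1) = a i * b j - p i j := by field_simp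
      rw [h5] at h4
      rw [Real.negMulLog]
      linarith
  have e1 : partitionEntropy μ (fun ω => (f ω, g ω)) = ∑ i, ∑ j, Real.negMulLog (p i j) := by
    unfold partitionEntropy
    rw [Fintype.sum_prod_type]
    rfl
  have s1 : ∑ i, ∑ j, p i j * Real.log (a i) = -partitionEntropy μ f := by
    simp_rw [← Finset.sum_mul, pa]
    simp [partitionEntropy, Real.negMulLog, ha, measureReal_def]
  have s2 : ∑ i, ∑ j, p i j * Real.log (b j) = -partitionEntropy μ g := by
    rw [Finset.sum_comm]
    simp_rw [← Finset.sum_mul, pb]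
    simp [partitionEntropy, Real.negMulLog, hb, measureReal_def]
  have s3 : ∑ i, ∑ j, a i * b j = 1 := by
    simp_rw [← Finset.mul_sum, b1, mul_one, a1]
  have s4 : ∑ i, ∑ j, p i j = 1 := by simp_rw [pa, a1]
  rw [e1]
  refine (Finset.sum_le_sum fun i _ => Finset.sum_le_sum fun j _ => key i j).trans ?_
  simp only [Finset.sum_add_distrib, Finset.sum_sub_distrib, Finset.sum_neg_distrib]
  rw [s1, s2, s3, s4]
  linarith

lemma partitionEntropy_pi_le {ι : Type*} [Fintype I] [MeasurableSpace I]
    [MeasurableSingletonClass I] (μ : Measure Ω) [IsProbabilityMeasure μ] (f : ι → Ω → I)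
    (hf : ∀ i, Measurable (f i)) (s : Finset ι) [Fintype (s → I)] :
    partitionEntropy μ (fun ω => fun i : s => f i ω) ≤ ∑ i ∈ s, partitionEntropy μ (f i) := by
  classical
  rename_i inst
  have : inst = Pi.instFintype := Subsingleton.elim _ _
  subst this
  induction s using Finset.induction_on with
  | empty =>
    have h : (fun ω => fun i : (∅ : Finset ι) => f i ω) ⁻¹' {default} = Set.univ := by
      ext; simp [eq_iff_true_of_subsingleton]
    simp [partitionEntropy, h]
  | insert a s ha ih =>
    rw [Finset.sum_insert ha]
    have hm : Measurable fun ω => fun i : s => f i ω := measurable_pi_lambda _ fun i => hf i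
    refine le_trans ?_ (add_le_add_right ih _)
    refine le_trans ?_ (partitionEntropy_prodMk_le μ (hf a) hm)
    refine partitionEntropy_le_of_factorsThrough μ ((hf a).prodMk hm) fun x y h => ?_
    rw [Prod.mk.injEq] at h
    funext ⟨i, hi⟩
    rcases Finset.mem_insert.1 hi with rfl | hi
    · exact h.1
    · exact congrFun h.2 ⟨i, hi⟩

lemma partitionEntropy_comp [Fintype I] [MeasurableSpace I]
    [MeasurableSingletonClass I] {Ω' : Type*} [MeasurableSpace Ω'] {μ : Measure Ω}
    {ν : Measure Ω'} {φ : Ω → Ω'} (hφ : MeasurePreserving φ μ ν) {f : Ω' → I}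
    (hf : Measurable f) : partitionEntropy μ (fun ω => f (φ ω)) = partitionEntropy ν f := by
  unfold partitionEntropy
  refine Finset.sum_congr rfl fun i _ => ?_
  rw [← hφ.measure_preimage (hf (measurableSet_singleton i)).nullMeasurableSet]
  rfl

lemma partitionEntropy_mem (μ : Measure Ω) [IsProbabilityMeasure μ] {E : Set Ω}
    (hE : MeasurableSet E) : partitionEntropy μ (fun ω => ω ∈ E) =
      Real.negMulLog (μ.real E) + Real.negMulLog (1 - μ.real E) := by
  have h1 : (fun ω => ω ∈ E) ⁻¹' {True} = E := by ext; simp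
  have h2 : (fun ω => ω ∈ E) ⁻¹' {False} = Eᶜ := by ext; simp
  rw [partitionEntropy, Fintype.univ_Prop, Finset.sum_pair (by simp), h1, h2, ← probReal_compl_eq_one_sub hE]
  rfl

lemma exists_forall_negMulLog_add_le {ε : ℝ} (hε : 0 < ε) :
    ∃ δ > 0, ∀ t, 0 ≤ t → t ≤ δ → Real.negMulLog t + Real.negMulLog (1 - t) ≤ ε := by
  have hc : Continuous fun t => Real.negMulLog t + Real.negMulLog (1 - t) := by
    have := Real.continuous_negMulLog
    fun_prop
  have h0 : ∀ᶠ t in 𝓝 (0 : ℝ), Real.negMulLog t + Real.negMulLog (1 - t) < ε :=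
    hc.continuousAt.eventually_lt continuousAt_const (by simpa using hε)
  obtain ⟨δ, hδ, h⟩ := Metric.eventually_nhds_iff.1 h0
  refine ⟨δ / 2, by positivity, fun t ht ht' => (h ?_).le⟩
  rw [Real.dist_eq, sub_zero, abs_of_nonneg ht]
  linarith

/-- Replacing each set `A p` by a set `B p` whose symmetric difference with `A p` has small
indicator entropy changes the entropy of a finite join by at most the sum of these errors. -/
lemma partitionEntropy_family_le_add {ι : Type*} (μ : Measure Ω) [IsProbabilityMeasure μ]
    {A B : ι → Set Ω} (hA : ∀ i, MeasurableSet (A i)) (hB : ∀ i, MeasurableSet (B i))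
    (s : Finset ι) [Fintype (s → Prop)] {ε : ℝ}
    (h : ∀ i ∈ s, partitionEntropy μ (fun ω => ω ∈ A i ∆ B i) ≤ ε) :
    partitionEntropy μ (fun ω => fun i : s => ω ∈ A i) ≤
      partitionEntropy μ (fun ω => fun i : s => ω ∈ B i) + s.card * ε := by
  have hm : ∀ C : ι → Set Ω, (∀ i, MeasurableSet (C i)) →
      Measurable fun ω => fun i : s => ω ∈ C i :=
    fun C hC => measurable_pi_lambda _ fun i => measurable_mem.2 (hC i)
  have hD : ∀ i, MeasurableSet (A i ∆ B i) := fun i => (hA i).symmDiff (hB i)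
  have h1 : partitionEntropy μ (fun ω => fun i : s => ω ∈ A i ∆ B i) ≤ s.card * ε := by
    refine (partitionEntropy_pi_le μ (fun i ω => ω ∈ A i ∆ B i)
      (fun i => measurable_mem.2 (hD i)) s).trans ?_
    rw [← nsmul_eq_mul]
    exact Finset.sum_le_card_nsmul _ _ _ h
  refine le_trans ?_ (add_le_add_right h1 _)
  refine le_trans ?_ (partitionEntropy_prodMk_le μ (hm B hB) (hm _ hD))
  refine partitionEntropy_le_of_factorsThrough μ ((hm B hB).prodMk (hm _ hD)) fun x y hxy => ?_
  rw [Prod.mk.injEq] at hxy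
  funext i
  have e1 := congrFun hxy.1 i
  have e2 := congrFun hxy.2 i
  simp only [Set.mem_symmDiff, eq_iff_iff] at e1 e2 ⊢
  tauto

end Entropy

section Dynamics

variable {X I J : Type*} [mX : MeasurableSpace X]

lemma measurePreserving_zpow {μ : Measure X} {T : X ≃ᵐ X} (hT : MeasurePreserving T μ μ) (p : ℤ) :
    MeasurePreserving (⇑(T.toEquiv ^ p)) μ μ := by
  induction p using Int.induction_on with
  | zero => exact MeasurePreserving.id μ
  | succ n ih =>
    rw [zpow_add_one]
    exact ih.comp hT
  | pred n ih =>
    rw [zpow_sub_one]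
    exact ih.comp (hT.symm T)

lemma measurePreserving_prodMap_zpow {Y : Type*} [MeasurableSpace Y] {lam : Measure (X × Y)}
    {T : X ≃ᵐ X} {S : Y ≃ᵐ Y} (h : MeasurePreserving (Prod.map T S) lam lam) (p : ℤ) :
    MeasurePreserving (Prod.map (T.toEquiv ^ p) (S.toEquiv ^ p)) lam lam := by
  have h' : MeasurePreserving (T.prodCongr S) lam lam := h
  induction p using Int.induction_on with
  | zero => exact MeasurePreserving.id lam
  | succ n ih =>
    rw [zpow_add_one, zpow_add_one]
    exact ih.comp h'
  | pred n ih =>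
    rw [zpow_sub_one, zpow_sub_one]
    exact ih.comp (h'.symm (T.prodCongr S))

lemma measurable_zpow (T : X ≃ᵐ X) (p : ℤ) : Measurable (⇑(T.toEquiv ^ p)) := by
  induction p using Int.induction_on with
  | zero => exact measurable_id
  | succ n ih =>
    rw [zpow_add_one]
    exact ih.comp T.measurable
  | pred n ih =>
    rw [zpow_sub_one]
    exact ih.comp T.symm.measurable

lemma measurable_name [MeasurableSpace I] (T : X ≃ᵐ X) (s : Finset ℤ) {f : X → I}
    (hf : Measurable f) : Measurable fun x => fun p : s => f ((T.toEquiv ^ (p : ℤ)) x) :=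
  measurable_pi_lambda _ fun p => hf.comp (measurable_zpow T p)

lemma hPj_nonneg [Fintype I] (μ : Measure X) [IsProbabilityMeasure μ] (T : X ≃ᵐ X)
    (s : Finset ℤ) (f : X → I) : 0 ≤ hPj μ T s f :=
  div_nonneg (partitionEntropy_nonneg μ _) (Nat.cast_nonneg _)

lemma hPj_le_of_factorsThrough [Fintype I] [MeasurableSpace I] [MeasurableSingletonClass I]
    [Fintype J] (μ : Measure X) [IsProbabilityMeasure μ] (T : X ≃ᵐ X) (s : Finset ℤ)
    {f : X → I} (hf : Measurable f) {g : X → J} (hgf : FactorsThrough g f) :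
    hPj μ T s g ≤ hPj μ T s f := by
  refine div_le_div_of_nonneg_right ?_ (Nat.cast_nonneg _)
  refine partitionEntropy_le_of_factorsThrough μ (measurable_name T s hf) fun x y h => ?_
  funext p
  exact hgf (congrFun h p)

lemma hPj_prodMk_le [Fintype I] [MeasurableSpace I] [MeasurableSingletonClass I]
    [Fintype J] [MeasurableSpace J] [MeasurableSingletonClass J]
    (μ : Measure X) [IsProbabilityMeasure μ] (T : X ≃ᵐ X) (s : Finset ℤ)
    {f : X → I} (hf : Measurable f) {g : X → J} (hg : Measurable g) :
    hPj μ T s (fun x => (f x, g x)) ≤ hPj μ T s f + hPj μ T s g := by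
  unfold hPj
  rw [← add_div]
  refine div_le_div_of_nonneg_right ?_ (Nat.cast_nonneg _)
  refine le_trans ?_ (partitionEntropy_prodMk_le μ (measurable_name T s hf)
    (measurable_name T s hg))
  refine partitionEntropy_le_of_factorsThrough μ
    ((measurable_name T s hf).prodMk (measurable_name T s hg)) fun x y h => ?_
  rw [Prod.mk.injEq] at h
  funext p
  exact Prod.ext (congrFun h.1 p) (congrFun h.2 p)

lemma hPj_pi_le {ι : Type*} [Fintype I] [MeasurableSpace I] [MeasurableSingletonClass I]
    (μ : Measure X) [IsProbabilityMeasure μ] (T : X ≃ᵐ X) (s : Finset ℤ) (f : ι → X → I)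
    (hf : ∀ i, Measurable (f i)) (t : Finset ι) [Fintype (t → I)] :
    hPj μ T s (fun x => fun i : t => f i x) ≤ ∑ i ∈ t, hPj μ T s (f i) := by
  classical
  unfold hPj
  rw [← Finset.sum_div]
  refine div_le_div_of_nonneg_right ?_ (Nat.cast_nonneg _)
  have hm := fun i => measurable_name T s (hf i)
  refine le_trans ?_ (partitionEntropy_pi_le μ
    (fun i x => fun p : s => f i ((T.toEquiv ^ (p : ℤ)) x)) hm t)
  refine partitionEntropy_le_of_factorsThrough μ
    (measurable_pi_lambda _ fun i : t => hm i) fun x y h => ?_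
  funext p i
  exact congrFun (congrFun h i) p

lemma hPj_le_partitionEntropy [Fintype I] [MeasurableSpace I] [MeasurableSingletonClass I]
    {μ : Measure X} [IsProbabilityMeasure μ] {T : X ≃ᵐ X} (hT : MeasurePreserving T μ μ)
    {s : Finset ℤ} (hs : s.Nonempty) {f : X → I} (hf : Measurable f) :
    hPj μ T s f ≤ partitionEntropy μ f := by
  have hc : (0 : ℝ) < s.card := Nat.cast_pos.2 hs.card_pos
  rw [hPj, div_le_iff₀ hc, mul_comm, ← nsmul_eq_mul]
  refine (partitionEntropy_pi_le μ (fun p x => f ((T.toEquiv ^ p) x))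
    (fun p => hf.comp (measurable_zpow T p)) s).trans ?_
  exact Finset.sum_le_card_nsmul _ _ _ fun p _ =>
    (partitionEntropy_comp (measurePreserving_zpow hT p) hf).le

lemma hPj_comp_zpow [Fintype I] [MeasurableSpace I] [MeasurableSingletonClass I]
    {μ : Measure X} {T : X ≃ᵐ X} (hT : MeasurePreserving T μ μ) (s : Finset ℤ) {f : X → I}
    (hf : Measurable f) (k : ℤ) : hPj μ T s (fun x => f ((T.toEquiv ^ k) x)) = hPj μ T s f := by
  unfold hPj
  rw [← partitionEntropy_comp (measurePreserving_zpow hT k) (measurable_name T s hf)]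
  simp_rw [← Equiv.Perm.mul_apply, ← zpow_add, add_comm k]

lemma hPj_mem_le_add {μ : Measure X} [IsProbabilityMeasure μ] {T : X ≃ᵐ X}
    (hT : MeasurePreserving T μ μ) {s : Finset ℤ} (hs : s.Nonempty) {A B : Set X}
    (hA : MeasurableSet A) (hB : MeasurableSet B) :
    hPj μ T s (fun x => x ∈ A) ≤
      hPj μ T s (fun x => x ∈ B) + partitionEntropy μ (fun x => x ∈ A ∆ B) := by
  have hc : (0 : ℝ) < s.card := Nat.cast_pos.2 hs.card_pos
  unfold hPj
  rw [div_le_iff₀ hc, add_mul, div_mul_cancel₀ _ hc.ne', mul_comm (partitionEntropy _ _)]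
  refine partitionEntropy_family_le_add μ (A := fun p : ℤ => (T.toEquiv ^ p) ⁻¹' A)
    (B := fun p : ℤ => (T.toEquiv ^ p) ⁻¹' B) (fun p => measurable_zpow T p hA)
    (fun p => measurable_zpow T p hB) s fun p _ => ?_
  exact (partitionEntropy_comp (measurePreserving_zpow hT p)
    (measurable_mem.2 (hA.symmDiff hB))).le

/-- A measurable set has zero `P`-entropy if the normalized entropies of the partition into the
set and its complement tend to zero. -/
def IsZeroEntropySet (μ : Measure X) (T : X ≃ᵐ X) (P : ℕ → Finset ℤ) (A : Set X) : Prop :=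
  MeasurableSet A ∧ Tendsto (fun j => hPj μ T (P j) (fun x => x ∈ A)) atTop (𝓝 0)

lemma IsZeroEntropySet.of_factorsThrough [Fintype I] [MeasurableSpace I]
    [MeasurableSingletonClass I] {μ : Measure X} [IsProbabilityMeasure μ] {T : X ≃ᵐ X}
    {P : ℕ → Finset ℤ} {f : X → I} (hf : Measurable f)
    (hf0 : Tendsto (fun j => hPj μ T (P j) f) atTop (𝓝 0)) {A : Set X} (hA : MeasurableSet A)
    (hAf : FactorsThrough (fun x => x ∈ A) f) : IsZeroEntropySet μ T P A :=
  ⟨hA, squeeze_zero (fun _ => hPj_nonneg μ T _ _)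
    (fun _ => hPj_le_of_factorsThrough μ T _ hf hAf) hf0⟩

lemma IsZeroEntropySet.compl {μ : Measure X} [IsProbabilityMeasure μ] {T : X ≃ᵐ X}
    {P : ℕ → Finset ℤ} {A : Set X} (hA : IsZeroEntropySet μ T P A) :
    IsZeroEntropySet μ T P Aᶜ :=
  .of_factorsThrough (measurable_mem.2 hA.1) hA.2 hA.1.compl fun _ _ h => congrArg Not h

lemma IsZeroEntropySet.union {μ : Measure X} [IsProbabilityMeasure μ] {T : X ≃ᵐ X}
    {P : ℕ → Finset ℤ} {A B : Set X} (hA : IsZeroEntropySet μ T P A)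
    (hB : IsZeroEntropySet μ T P B) : IsZeroEntropySet μ T P (A ∪ B) := by
  have hA' := measurable_mem.2 hA.1
  have hB' := measurable_mem.2 hB.1
  refine .of_factorsThrough (hA'.prodMk hB') ?_ (hA.1.union hB.1) fun x y h => ?_
  · exact squeeze_zero (fun _ => hPj_nonneg μ T _ _)
      (fun _ => hPj_prodMk_le μ T _ hA' hB') (by simpa using hA.2.add hB.2)
  · rw [Prod.mk.injEq] at h
    exact congrArg₂ Or h.1 h.2

lemma isZeroEntropySet_of_forall_le {μ : Measure X} [IsProbabilityMeasure μ]
    {T : X ≃ᵐ X} {P : ℕ → Finset ℤ} {A : Set X} (hA : MeasurableSet A)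
    (h : ∀ ε > 0, ∃ u : ℕ → ℝ, Tendsto u atTop (𝓝 0) ∧
      ∀ j, hPj μ T (P j) (fun x => x ∈ A) ≤ u j + ε) : IsZeroEntropySet μ T P A := by
  refine ⟨hA, tendsto_order.2 ⟨fun a ha => Eventually.of_forall fun j =>
    ha.trans_le (hPj_nonneg μ T _ _), fun a ha => ?_⟩⟩
  obtain ⟨u, hu, hle⟩ := h (a / 2) (half_pos ha)
  filter_upwards [hu.eventually_lt_const (half_pos ha)] with j hj
  linarith [hle j]

lemma IsZeroEntropySet.iUnion {μ : Measure X} [IsProbabilityMeasure μ] {T : X ≃ᵐ X}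
    (hT : MeasurePreserving T μ μ) {P : ℕ → Finset ℤ} (hP : ∀ j, (P j).Nonempty)
    {A : ℕ → Set X} (hA : ∀ n, IsZeroEntropySet μ T P (A n)) :
    IsZeroEntropySet μ T P (⋃ n, A n) := by
  have hacc : ∀ n, IsZeroEntropySet μ T P (Set.accumulate A n) := fun n => by
    induction n with
    | zero => simpa using hA 0
    | succ n ih =>
      rw [Set.accumulate_succ]
      exact ih.union (hA _)
  have hU : MeasurableSet (⋃ n, A n) := .iUnion fun n => (hA n).1
  refine isZeroEntropySet_of_forall_le hU fun ε hε => ?_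
  obtain ⟨δ, hδ, hle⟩ := exists_forall_negMulLog_add_le hε
  have hlim : Tendsto (fun n => μ.real (Set.accumulate A n)) atTop (𝓝 (μ.real (⋃ n, A n))) :=
    (ENNReal.tendsto_toReal (measure_ne_top _ _)).comp tendsto_measure_iUnion_accumulate
  obtain ⟨n, hn⟩ := (hlim.eventually_const_lt (sub_lt_self _ hδ)).exists
  have hsub : Set.accumulate A n ⊆ ⋃ n, A n := Set.accumulate_subset_iUnion n
  refine ⟨_, (hacc n).2, fun j => (hPj_mem_le_add hT (hP j) hU (hacc n).1).trans
    (add_le_add_right ?_ _)⟩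
  rw [partitionEntropy_mem μ (hU.symmDiff (hacc n).1)]
  refine hle _ measureReal_nonneg ?_
  rw [Set.symmDiff_def, Set.sdiff_eq_empty.2 hsub, Set.union_empty,
    measureReal_sdiff hsub (hacc n).1]
  linarith

/-- The `P`-Pinsker algebra: the σ-algebra of all sets of zero `P`-entropy. -/
abbrev pinskerAlgebra {μ : Measure X} [IsProbabilityMeasure μ] {T : X ≃ᵐ X}
    (hT : MeasurePreserving T μ μ) {P : ℕ → Finset ℤ} (hP : ∀ j, (P j).Nonempty) :
    MeasurableSpace X where
  MeasurableSet' := IsZeroEntropySet μ T P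
  measurableSet_empty :=
    isZeroEntropySet_of_forall_le .empty fun ε hε => ⟨_, tendsto_const_nhds, fun j => by
      refine (hPj_le_partitionEntropy hT (hP j) (measurable_mem.2 .empty)).trans ?_
      rw [partitionEntropy_mem μ .empty]
      simpa using hε.le⟩
  measurableSet_compl _ h := h.compl
  measurableSet_iUnion _ h := .iUnion hT hP h

lemma invariantSubAlg_pinskerAlgebra {μ : Measure X} [IsProbabilityMeasure μ] {T : X ≃ᵐ X}
    (hT : MeasurePreserving T μ μ) {P : ℕ → Finset ℤ} (hP : ∀ j, (P j).Nonempty) :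
    InvariantSubAlg μ T (pinskerAlgebra hT hP) := by
  have key : ∀ (k : ℤ) (s : Set X), IsZeroEntropySet μ T P s →
      IsZeroEntropySet μ T P ((T.toEquiv ^ k) ⁻¹' s) := fun k s hs =>
    ⟨measurable_zpow T k hs.1, hs.2.congr fun j =>
      (hPj_comp_zpow hT (P j) (measurable_mem.2 hs.1) k).symm⟩
  have hsymm : ⇑(T.toEquiv ^ (-1 : ℤ)) = T.symm := by
    rw [zpow_neg_one]
    rfl
  refine ⟨fun s hs => ⟨T ⁻¹' s, key 1 s hs, by simp⟩,
    fun t ht => ⟨_, key (-1) t ht, ?_⟩⟩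
  rw [hsymm, ← Set.preimage_comp, MeasurableEquiv.symm_comp_self]
  simp

lemma tendsto_hPj_of_hPpart_le_zero [Fintype I] [MeasurableSpace I] [MeasurableSingletonClass I]
    {μ : Measure X} [IsProbabilityMeasure μ] {T : X ≃ᵐ X} (hT : MeasurePreserving T μ μ)
    {P : ℕ → Finset ℤ} (hP : ∀ j, (P j).Nonempty) {f : X → I} (hf : Measurable f)
    (h : hPpart μ T P f ≤ 0) : Tendsto (fun j => hPj μ T (P j) f) atTop (𝓝 0) := by
  refine tendsto_order.2 ⟨fun a ha => Eventually.of_forall fun j =>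
    ha.trans_le (hPj_nonneg μ T _ _), fun a ha => ?_⟩
  exact eventually_lt_of_limsup_lt (h.trans_lt ha)
    (isBoundedUnder_of ⟨_, fun j => hPj_le_partitionEntropy hT (hP j) hf⟩)

lemma isZeroEntropySet_of_hPent_eq_zero {μ : Measure X} [IsProbabilityMeasure μ] {T : X ≃ᵐ X}
    (hT : MeasurePreserving T μ μ) {P : ℕ → Finset ℤ} (hP : ∀ j, (P j).Nonempty)
    (h : hPent μ T P = 0) {A : Set X} (hA : MeasurableSet A) : IsZeroEntropySet μ T P A := by
  classical
  let f : X → Fin 2 := fun x => if x ∈ A then 1 else 0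
  have hf : Measurable f := Measurable.ite hA measurable_const measurable_const
  refine .of_factorsThrough hf (tendsto_hPj_of_hPpart_le_zero hT hP hf ?_) hA fun x y hxy => ?_
  · simp only [hPent, hPfactor, ENNReal.iSup_eq_zero, ENNReal.ofReal_eq_zero] at h
    exact h 2 f hf
  · by_cases hx : x ∈ A <;> by_cases hy : y ∈ A <;> simp_all [f]

lemma hPfactor_pinskerAlgebra {μ : Measure X} [IsProbabilityMeasure μ] {T : X ≃ᵐ X}
    (hT : MeasurePreserving T μ μ) {P : ℕ → Finset ℤ} (hP : ∀ j, (P j).Nonempty) :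
    hPfactor (pinskerAlgebra hT hP) μ T P = 0 := by
  simp only [hPfactor, ENNReal.iSup_eq_zero, ENNReal.ofReal_eq_zero]
  intro n f hf
  have hz : ∀ i, IsZeroEntropySet μ T P (f ⁻¹' {i}) := fun i => hf (measurableSet_singleton i)
  have hm : ∀ i, Measurable fun x => x ∈ f ⁻¹' {i} := fun i => measurable_mem.2 (hz i).1
  have hle : ∀ j, hPj μ T (P j) f ≤ ∑ i, hPj μ T (P j) (fun x => x ∈ f ⁻¹' {i}) := fun j => by
    refine le_trans ?_ (hPj_pi_le μ T (P j) (fun i x => x ∈ f ⁻¹' {i}) hm Finset.univ)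
    refine hPj_le_of_factorsThrough μ T (P j)
      (f := fun x => fun i : (Finset.univ : Finset (Fin n)) => x ∈ f ⁻¹' {(i : Fin n)})
      (measurable_pi_lambda _ fun i => hm i) fun x y h => ?_
    have h' := congrFun h ⟨f y, Finset.mem_univ _⟩
    simpa using h'
  have hlim : Tendsto (fun j => hPj μ T (P j) f) atTop (𝓝 0) :=
    squeeze_zero (fun _ => hPj_nonneg μ T _ _) hle
      (by simpa using tendsto_finsetSum Finset.univ fun i _ => (hz i).2)
  exact hlim.limsup_eq.le

end Dynamics

section Joining

lemma measure_pi_average_le {U : Type*} [MeasurableSpace U] (ρ : Measure U)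
    [IsProbabilityMeasure ρ] {E : Set U} (hE : MeasurableSet E) {N : ℕ} (hN : 0 < N) {η : ℝ}
    (hη : 0 < η) :
    Measure.pi (fun _ : Fin N => ρ)
      {u | η ≤ |(∑ i, E.indicator (1 : U → ℝ) (u i)) / N - ρ.real E|} ≤
      ENNReal.ofReal (1 / (N * η ^ 2)) := by
  have hN' : (0 : ℝ) < N := Nat.cast_pos.2 hN
  set g : U → ℝ := E.indicator 1 with hg
  have hgm : Measurable g := measurable_one.indicator hE
  have hg0 : ∀ v, g v ∈ Set.Icc (0 : ℝ) 1 := fun v => by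
    by_cases hv : v ∈ E <;> simp [hg, hv]
  have hgL : MemLp g 2 ρ := memLp_of_bounded (Eventually.of_forall hg0) hgm.aestronglyMeasurable 2
  set π := Measure.pi (fun _ : Fin N => ρ) with hπ
  have hev : ∀ i : Fin N, MeasurePreserving (fun u : Fin N → U => u i) π ρ := fun i =>
    measurePreserving_eval (fun _ : Fin N => ρ) i
  have hiL : ∀ i : Fin N, MemLp (fun u : Fin N → U => g (u i)) 2 π := fun i =>
    hgL.comp_measurePreserving (hev i)
  have hint : ∫ v, g v ∂ρ = ρ.real E := by rw [hg, integral_indicator_one hE]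
  set Ξ : (Fin N → U) → ℝ := ∑ i, fun u : Fin N → U => g (u i) with hΞ
  have hΞL : MemLp Ξ 2 π := memLp_finsetSum' _ fun i _ => hiL i
  have hmean : ∫ u, Ξ u ∂π = N * ρ.real E := by
    simp only [hΞ, Finset.sum_apply]
    rw [integral_finsetSum _ fun i _ => (hiL i).integrable (by norm_num)]
    have : ∀ i : Fin N, ∫ u, g (u i) ∂π = ρ.real E := fun i => by
      rw [← hint, ← (hev i).map_eq,
        integral_map (hev i).measurable.aemeasurable hgm.aestronglyMeasurable]
    simp [this]
  have hvar : variance Ξ π ≤ N := by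
    rw [hΞ, hπ, variance_sum_pi fun _ => hgL]
    have h1 : variance g ρ ≤ 1 :=
      (variance_le_sq_of_bounded (Eventually.of_forall hg0) hgm.aemeasurable).trans (by norm_num)
    simpa using mul_le_mul_of_nonneg_left h1 hN'.le
  have hset : {u : Fin N → U | η ≤ |(∑ i, g (u i)) / N - ρ.real E|} =
      {u | N * η ≤ |Ξ u - ∫ u, Ξ u ∂π|} := by
    ext u
    have h1 : Ξ u - N * ρ.real E = N * ((∑ i, g (u i)) / N - ρ.real E) := by
      rw [hΞ, Finset.sum_apply]
      field_simp
    rw [Set.mem_ofPred_eq, Set.mem_ofPred_eq, hmean, h1, abs_mul, abs_of_pos hN',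
      mul_le_mul_iff_right₀ hN']
  rw [hset]
  refine (meas_ge_le_variance_div_sq hΞL (by positivity)).trans (ENNReal.ofReal_le_ofReal ?_)
  rw [div_le_div_iff₀ (by positivity) (by positivity)]
  calc variance Ξ π * (N * η ^ 2) ≤ N * (N * η ^ 2) := by gcongr
    _ = 1 * (N * η) ^ 2 := by ring

variable {X Y : Type*} [mX : MeasurableSpace X] [mY : MeasurableSpace Y]

lemma ae_kernel_preimage_eq {lam : Measure (X × Y)} {μ : Measure X} [IsProbabilityMeasure μ]
    {κ : Kernel X Y} [IsMarkovKernel κ] (hlam : μ ⊗ₘ κ = lam) {T : X ≃ X} {S : Y → Y}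
    (hT : MeasurePreserving T μ μ) (hTs : Measurable T.symm)
    (hS : Measurable S) (hTS : MeasurePreserving (Prod.map T S) lam lam)
    {A : Set Y} (hA : MeasurableSet A) :
    ∀ᵐ x ∂μ, κ x (S ⁻¹' A) = κ (T x) A := by
  refine ae_eq_of_forall_setLIntegral_eq_of_sigmaFinite (κ.measurable_coe (hS hA))
    ((κ.measurable_coe hA).comp hT.measurable) fun C hC _ => ?_
  have hC' : MeasurableSet (T.symm ⁻¹' C) := hTs hC
  have hCC : T ⁻¹' (T.symm ⁻¹' C) = C := by
    ext; simp
  have h1 := hTS.measure_preimage (hC'.prod hA).nullMeasurableSet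
  rw [Set.preimage_prod_map_prod, hCC, ← hlam, Measure.compProd_apply_prod hC (hS hA),
    Measure.compProd_apply_prod hC' hA] at h1
  rw [h1, ← hT.setLIntegral_comp_preimage hC' (κ.measurable_coe hA), hCC]

lemma isZeroEntropySet_kernel_superlevel [StandardBorelSpace Y] [Nonempty Y]
    {μ : Measure X} [IsProbabilityMeasure μ] {T : X ≃ᵐ X} (hT : MeasurePreserving T μ μ)
    {ν : Measure Y} {S : Y ≃ᵐ Y} {P : ℕ → Finset ℤ} (hP : ∀ j, (P j).Nonempty)
    {κ : Kernel X Y} [IsMarkovKernel κ]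
    (hTS : MeasurePreserving (Prod.map T S) (μ ⊗ₘ κ) (μ ⊗ₘ κ)) (hsnd : (μ ⊗ₘ κ).map Prod.snd = ν)
    {A : Set Y} (hA : IsZeroEntropySet ν S P A) {c : ℝ} (hc : μ {x | (κ x).real A = c} = 0) :
    IsZeroEntropySet μ T P {x | c < (κ x).real A} := by
  have hφ : Measurable fun x => (κ x).real A := (κ.measurable_coe hA.1).ennreal_toReal
  have hB : MeasurableSet {x | c < (κ x).real A} := measurableSet_lt measurable_const hφ
  refine isZeroEntropySet_of_forall_le hB fun ε hε => ?_
  obtain ⟨δ, hδ, hle⟩ := exists_forall_negMulLog_add_le hε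
  have hδ' : (0 : ENNReal) < ENNReal.ofReal (δ / 2) := ENNReal.ofReal_pos.2 (half_pos hδ)
  obtain ⟨η, hη, hηle⟩ : ∃ η > 0, μ {x | |(κ x).real A - c| ≤ η} ≤ ENNReal.ofReal (δ / 2) := by
    have hmono : Antitone fun n : ℕ => {x | |(κ x).real A - c| ≤ 1 / ((n : ℝ) + 1)} :=
      fun m n hmn x hx => by
        simp only [Set.mem_ofPred_eq] at hx ⊢
        exact hx.trans (Nat.one_div_le_one_div hmn)
    have hlim := tendsto_measure_iInter_atTop (μ := μ)
      (s := fun n : ℕ => {x | |(κ x).real A - c| ≤ 1 / ((n : ℝ) + 1)})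
      (fun n => (measurableSet_le (hφ.sub_const c).abs measurable_const).nullMeasurableSet)
      hmono ⟨0, measure_ne_top _ _⟩
    have hInt : ⋂ n : ℕ, {x | |(κ x).real A - c| ≤ 1 / ((n : ℝ) + 1)} =
        {x | (κ x).real A = c} := by
      ext x
      simp only [Set.mem_iInter, Set.mem_ofPred_eq]
      refine ⟨fun h => ?_, fun h n => ?_⟩
      · have := ge_of_tendsto' tendsto_one_div_add_atTop_nhds_zero_nat h
        exact sub_eq_zero.1 (abs_nonpos_iff.1 this)
      · rw [h, sub_self, abs_zero]
        positivity
    rw [hInt, hc] at hlim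
    obtain ⟨n, hn⟩ := (hlim.eventually_lt_const hδ').exists
    exact ⟨1 / ((n : ℝ) + 1), by positivity, hn.le⟩
  obtain ⟨N, hN, hNle⟩ : ∃ N : ℕ, 0 < N ∧ 1 / ((N : ℝ) * η ^ 2) ≤ δ / 2 := by
    obtain ⟨N, hN⟩ := exists_nat_gt (1 / (δ / 2 * η ^ 2))
    have hN0 : (0 : ℝ) < N := lt_trans (by positivity) hN
    refine ⟨N, Nat.cast_pos.1 hN0, ?_⟩
    rw [div_lt_iff₀ (by positivity)] at hN
    rw [div_le_iff₀ (by positivity)]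
    linarith
  obtain ⟨f, hf, hfκ⟩ := κ.exists_measurable_map_eq_unitInterval
  have hfx : ∀ x, Measurable (f x) := fun x => hf.comp measurable_prodMk_left
  let π : Measure (Fin N → unitInterval) := Measure.pi fun _ => volume
  let m : Measure (X × (Fin N → unitInterval)) := μ.prod π
  let y : Fin N → X × (Fin N → unitInterval) → Y := fun i z => f z.1 (z.2 i)
  have hym : ∀ i, Measurable (y i) := fun i =>
    hf.comp (measurable_fst.prodMk ((measurable_pi_apply i).comp measurable_snd))
  have hy : ∀ i, MeasurePreserving (y i) m ν := fun i => by
    have h1 : MeasurePreserving (Prod.map id fun u : Fin N → unitInterval => u i) m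
        (μ.prod volume) :=
      (MeasurePreserving.id μ).prod
        (measurePreserving_eval (fun _ : Fin N => (volume : Measure unitInterval)) i)
    have h2 : MeasurePreserving (uncurry f) (μ.prod volume) ν := by
      refine ⟨hf, Measure.ext fun C hC => ?_⟩
      rw [Measure.map_apply hf hC, Measure.prod_apply (hf hC), ← hsnd,
        Measure.map_apply measurable_snd hC, ← Set.univ_prod,
        Measure.compProd_apply_prod .univ hC, setLIntegral_univ]
      refine lintegral_congr fun x => ?_
      rw [← hfκ x, Measure.map_apply (hfx x) hC]
      rfl
    exact h2.comp h1
  let ψ : ℤ → X × (Fin N → unitInterval) → ℝ := fun p z =>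
    (∑ i, ((S.toEquiv ^ p) ⁻¹' A).indicator (1 : Y → ℝ) (y i z)) / N
  have hSA : ∀ p : ℤ, MeasurableSet ((S.toEquiv ^ p) ⁻¹' A) := fun p => measurable_zpow S p hA.1
  have hψ : ∀ p, Measurable (ψ p) := fun p =>
    (Finset.measurable_fun_sum _ fun i _ =>
      (measurable_one.indicator (hSA p)).comp (hym i)).div_const _
  let V : ℤ → Set (X × (Fin N → unitInterval)) := fun p =>
    {z | c < (κ ((T.toEquiv ^ p) z.1)).real A}
  let W : ℤ → Set (X × (Fin N → unitInterval)) := fun p => {z | c < ψ p z}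
  have hV : ∀ p, MeasurableSet (V p) := fun p =>
    measurable_fst (measurable_zpow T p hB)
  have hW : ∀ p, MeasurableSet (W p) := fun p => measurableSet_lt measurable_const (hψ p)
  have hVW : ∀ p, m.real (V p ∆ W p) ≤ δ := fun p => by
    have hTp := measurePreserving_zpow hT p
    have hfst : MeasurePreserving (Prod.fst : X × (Fin N → unitInterval) → X) m μ :=
      measurePreserving_fst
    have hae : ∀ᵐ x ∂μ, κ x ((S.toEquiv ^ p) ⁻¹' A) = κ ((T.toEquiv ^ p) x) A := by
      refine ae_kernel_preimage_eq rfl hTp ?_ (measurable_zpow S p)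
        (measurePreserving_prodMap_zpow hTS p) hA.1
      have : (T.toEquiv ^ p).symm = T.toEquiv ^ (-p) := (zpow_neg T.toEquiv p).symm
      rw [this]
      exact measurable_zpow T (-p)
    set D1 : Set (X × (Fin N → unitInterval)) :=
      {z | |(κ ((T.toEquiv ^ p) z.1)).real A - c| ≤ η} with hD1
    set D2 : Set (X × (Fin N → unitInterval)) :=
      {z | η ≤ |ψ p z - (κ z.1).real ((S.toEquiv ^ p) ⁻¹' A)|} with hD2
    have hsub : ∀ᵐ z ∂m, z ∈ V p ∆ W p → z ∈ D1 ∪ D2 := by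
      filter_upwards [hfst.quasiMeasurePreserving.ae hae] with z hz hzVW
      by_contra hcon
      simp only [Set.mem_union, hD1, hD2, Set.mem_ofPred_eq, not_or, not_le, measureReal_def,
        hz] at hcon
      have h1 := abs_lt.1 hcon.2
      simp only [Set.mem_symmDiff, V, W, Set.mem_ofPred_eq, measureReal_def, not_lt] at hzVW
      rcases lt_abs.1 hcon.1 with h2 | h2 <;> rcases hzVW with h3 | h3 <;> linarith
    have hm1 : m D1 ≤ ENNReal.ofReal (δ / 2) := by
      have h1 : MeasurableSet {x | |(κ x).real A - c| ≤ η} :=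
        measurableSet_le (hφ.sub_const c).abs measurable_const
      have h2 := (hTp.comp hfst).measure_preimage h1.nullMeasurableSet
      exact (h2.trans_le hηle)
    have hm2 : m D2 ≤ ENNReal.ofReal (δ / 2) := by
      have h1 : MeasurableSet D2 := by
        have hk : Measurable fun x => (κ x).real ((S.toEquiv ^ p) ⁻¹' A) :=
          (κ.measurable_coe (hSA p)).ennreal_toReal
        exact measurableSet_le measurable_const ((hψ p).sub (hk.comp measurable_fst)).abs
      rw [Measure.prod_apply h1]
      refine (lintegral_mono (g := fun _ => ENNReal.ofReal (δ / 2)) fun x => ?_).trans (by simp)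
      refine le_trans ?_ (ENNReal.ofReal_le_ofReal hNle)
      have h2 := measure_pi_average_le (volume : Measure unitInterval)
        (hfx x (hSA p)) hN hη
      have h3 : (volume : Measure unitInterval).real (f x ⁻¹' ((S.toEquiv ^ p) ⁻¹' A)) =
          (κ x).real ((S.toEquiv ^ p) ⁻¹' A) := by
        rw [← hfκ x, map_measureReal_apply (hfx x) (hSA p)]
      rw [h3] at h2
      exact h2
    refine ENNReal.toReal_le_of_le_ofReal hδ.le ?_
    calc m (V p ∆ W p) ≤ m (D1 ∪ D2) := measure_mono_ae hsub
      _ ≤ m D1 + m D2 := measure_union_le _ _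
      _ ≤ ENNReal.ofReal (δ / 2) + ENNReal.ofReal (δ / 2) := add_le_add hm1 hm2
      _ = ENNReal.ofReal δ := by
        rw [← ENNReal.ofReal_add (by positivity) (by positivity), add_halves]
  refine ⟨fun j => N * hPj ν S (P j) (fun y => y ∈ A), by simpa using hA.2.const_mul (N : ℝ),
    fun j => ?_⟩
  have hcard : (0 : ℝ) < (P j).card := Nat.cast_pos.2 (hP j).card_pos
  have hname := measurable_name S (P j) (measurable_mem.2 hA.1)
  have hWle : partitionEntropy m (fun z => fun p : P j => z ∈ W p) ≤
      N * partitionEntropy ν (fun y => fun p : P j => (S.toEquiv ^ (p : ℤ)) y ∈ A) := by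
    have hyn : ∀ i, Measurable fun z => fun p : P j => (S.toEquiv ^ (p : ℤ)) (y i z) ∈ A :=
      fun i => hname.comp (hym i)
    have h1 := partitionEntropy_pi_le m
      (fun i z => fun p : P j => (S.toEquiv ^ (p : ℤ)) (y i z) ∈ A) hyn Finset.univ
    simp only [fun i => partitionEntropy_comp (hy i) hname, Finset.sum_const, Finset.card_univ,
      Fintype.card_fin, nsmul_eq_mul] at h1
    refine le_trans ?_ h1
    refine partitionEntropy_le_of_factorsThrough m
      (measurable_pi_lambda _ fun i : (Finset.univ : Finset (Fin N)) => hyn i) fun z z' h => ?_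
    funext p
    have hψp : ψ p z = ψ p z' := by
      simp only [ψ]
      congr 1
      refine Finset.sum_congr rfl fun i _ => ?_
      have h2 : ((S.toEquiv ^ (p : ℤ)) (y i z) ∈ A) = ((S.toEquiv ^ (p : ℤ)) (y i z') ∈ A) :=
        congrFun (congrFun h ⟨i, Finset.mem_univ i⟩) p
      classical
      simp only [Set.indicator_apply, Set.mem_preimage, h2, Pi.one_apply]
    simp only [W, Set.mem_ofPred_eq, hψp]
  have hVle := partitionEntropy_family_le_add m hV hW (P j) (ε := ε) fun p _ => by
    rw [partitionEntropy_mem m ((hV p).symmDiff (hW p))]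
    exact hle _ measureReal_nonneg (hVW p)
  have hVeq : partitionEntropy m (fun z => fun p : P j => z ∈ V p) =
      partitionEntropy μ (fun x => fun p : P j =>
        (T.toEquiv ^ (p : ℤ)) x ∈ {x | c < (κ x).real A}) :=
    partitionEntropy_comp measurePreserving_fst (measurable_name T (P j) (measurable_mem.2 hB))
  rw [hVeq] at hVle
  unfold hPj
  rw [div_le_iff₀ hcard, add_mul, mul_assoc, div_mul_cancel₀ _ hcard.ne', mul_comm ε]
  linarith

lemma ae_eq_integral_of_superlevel {μ : Measure X} [IsProbabilityMeasure μ] {φ : X → ℝ}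
    (hφ : Measurable φ) (hint : Integrable φ μ)
    (h : ∀ c, μ {x | φ x = c} = 0 → μ {x | c < φ x} = 0 ∨ μ {x | c < φ x} = 1) :
    ∀ᵐ x ∂μ, φ x = ∫ x, φ x ∂μ := by
  have hcount : {c : ℝ | 0 < μ {x | φ x = c}}.Countable := Measure.countable_meas_level_set_pos hφ
  have hdense := hcount.dense_compl ℝ
  set a := ∫ x, φ x ∂μ with ha
  have hone : ∀ c, μ {x | c < φ x} = 1 → c ≤ a := fun c hc => by
    have hae : ∀ᵐ x ∂μ, c ≤ φ x := by
      have h1 : ∀ᵐ x ∂μ, x ∈ {x | c < φ x} :=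
        (prob_compl_eq_zero_iff (measurableSet_lt measurable_const hφ)).2 hc
      filter_upwards [h1] with x hx using le_of_lt hx
    simpa using integral_mono_ae (integrable_const c) hint hae
  have hzero : ∀ c, μ {x | c < φ x} = 0 → a ≤ c := fun c hc => by
    have hae : ∀ᵐ x ∂μ, φ x ≤ c := by
      rw [ae_iff]
      simpa using hc
    simpa using integral_mono_ae hint (integrable_const c) hae
  have hgood : ∀ s t : ℝ, s < t → ∃ c, μ {x | φ x = c} = 0 ∧ s < c ∧ c < t := fun s t hst => by
    obtain ⟨c, hc, hc'⟩ := hdense.exists_between hst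
    refine ⟨c, ?_, hc'⟩
    simpa using hc
  have hup : ∀ n : ℕ, ∀ᵐ x ∂μ, φ x ≤ a + 1 / ((n : ℝ) + 1) := fun n => by
    obtain ⟨c, hc, h1, h2⟩ := hgood a (a + 1 / ((n : ℝ) + 1)) (lt_add_of_pos_right _ (by positivity))
    have h3 : μ {x | c < φ x} = 0 := (h c hc).resolve_right fun h4 => h1.not_ge (hone c h4)
    have h4 : ∀ᵐ x ∂μ, ¬ c < φ x := by
      rw [ae_iff]
      simpa using h3
    filter_upwards [h4] with x hx using (not_lt.1 hx).trans h2.le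
  have hlow : ∀ n : ℕ, ∀ᵐ x ∂μ, a - 1 / ((n : ℝ) + 1) ≤ φ x := fun n => by
    obtain ⟨c, hc, h1, h2⟩ := hgood (a - 1 / ((n : ℝ) + 1)) a (sub_lt_self _ (by positivity))
    have h3 : μ {x | c < φ x} = 1 := (h c hc).resolve_left fun h4 => h2.not_ge (hzero c h4)
    have h4 : ∀ᵐ x ∂μ, x ∈ {x | c < φ x} :=
      (prob_compl_eq_zero_iff (measurableSet_lt measurable_const hφ)).2 h3
    filter_upwards [h4] with x hx using h1.le.trans (le_of_lt hx)
  filter_upwards [ae_all_iff.2 hup, ae_all_iff.2 hlow] with x h1 h2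
  have hlim := tendsto_one_div_add_atTop_nhds_zero_nat (𝕜 := ℝ)
  refine le_antisymm (ge_of_tendsto' (by simpa using hlim.const_add a) h1)
    (le_of_tendsto' (by simpa using hlim.const_sub a) h2)

end Joining

/-- Let `P = (P_j)` be a sequence of finite nonempty subsets of `ℤ`.
If `T` (on a standard probability space `(X, μ)`) has completely positive `P`-entropy
(`h_P(T, ℱ) > 0` for every nontrivial `T`-invariant sub-σ-algebra `ℱ`) and `S` (on a
standard probability space `(Y, ν)`) has `h_P(S) = 0`, then `T` and `S` are disjoint:
every `T × S`-invariant probability measure on `X × Y` with marginals `μ` and `ν` is the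
product measure `μ ⊗ ν`. -/
theorem disjoint_of_cpe_of_zero_P_entropy
    {X : Type*} [mX : MeasurableSpace X] [StandardBorelSpace X]
    (μ : Measure X) [IsProbabilityMeasure μ] (T : X ≃ᵐ X) (hT : MeasurePreserving T μ μ)
    {Y : Type*} [mY : MeasurableSpace Y] [StandardBorelSpace Y]
    (ν : Measure Y) [IsProbabilityMeasure ν] (S : Y ≃ᵐ Y) (hS : MeasurePreserving S ν ν)
    (P : ℕ → Finset ℤ) (hP : ∀ j, (P j).Nonempty)
    (hcpe : ∀ F : MeasurableSpace X, F ≤ mX → @InvariantSubAlg X mX μ (⇑T) F →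
      (∃ s : Set X, MeasurableSet[F] s ∧ 0 < μ s ∧ μ s < 1) →
      0 < @hPfactor X F mX μ T P)
    (hzero : hPent ν S P = 0) :
    ∀ lam : Measure (X × Y), IsProbabilityMeasure lam →
      MeasurePreserving (Prod.map T S) lam lam →
      lam.map Prod.fst = μ → lam.map Prod.snd = ν →
      lam = μ.prod ν := by
  intro lam hlam hTS hfst hsnd
  have : Nonempty Y := nonempty_of_isProbabilityMeasure ν
  have hdis : μ ⊗ₘ lam.condKernel = lam := by
    have h := lam.disintegrate lam.condKernel
    rwa [Measure.fst, hfst] at h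
  have htriv : ∀ B, IsZeroEntropySet μ T P B → μ B = 0 ∨ μ B = 1 := fun B hB => by
    by_contra! hcon
    have hpos := hcpe (pinskerAlgebra hT hP) (fun _ hs => hs.1)
      (invariantSubAlg_pinskerAlgebra hT hP)
      ⟨B, hB, pos_iff_ne_zero.2 hcon.1, lt_of_le_of_ne prob_le_one hcon.2⟩
    rw [hPfactor_pinskerAlgebra hT hP] at hpos
    exact hpos.false
  have hprod : ∀ C A, MeasurableSet C → MeasurableSet A → lam (C ×ˢ A) =
      ∫⁻ x in C, lam.condKernel x A ∂μ := fun C A hC hA => by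
    conv_lhs => rw [← hdis]
    exact Measure.compProd_apply_prod hC hA
  symm
  refine Measure.prod_eq fun C A hC hA => ?_
  have hφ : Measurable fun x => (lam.condKernel x).real A :=
    (lam.condKernel.measurable_coe hA).ennreal_toReal
  have hint : Integrable (fun x => (lam.condKernel x).real A) μ :=
    .of_bound hφ.aestronglyMeasurable 1 (Eventually.of_forall fun x => by
      rw [Real.norm_of_nonneg measureReal_nonneg]
      exact measureReal_le_one)
  have hae := ae_eq_integral_of_superlevel hφ hint fun c hc => htriv _
    (isZeroEntropySet_kernel_superlevel hT hP (by rwa [hdis]) (by rwa [hdis])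
      (isZeroEntropySet_of_hPent_eq_zero hS hP hzero hA) hc)
  set a := ∫ x, (lam.condKernel x).real A ∂μ
  have hae' : ∀ᵐ x ∂μ, lam.condKernel x A = ENNReal.ofReal a := by
    filter_upwards [hae] with x hx
    rw [← hx, ofReal_measureReal]
  have hprod' : ∀ C, MeasurableSet C → lam (C ×ˢ A) = ENNReal.ofReal a * μ C := fun C hC => by
    rw [hprod C A hC hA, lintegral_congr_ae (ae_restrict_of_ae hae'), setLIntegral_const]
  have hν : ν A = ENNReal.ofReal a := by
    rw [← hsnd, Measure.map_apply measurable_snd hA, ← Set.univ_prod, hprod' _ .univ]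
    simp
  rw [hprod' C hC, hν, mul_comm]
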